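/- arXiv:1605.01262 — 8 statements merged into one kernel-verified Lean document; each statement's English description precedes it below -/
import Mathlib

section
/- Let X ⊆ A be a set of removed vertices and define the cascading failure process by F_A^0 = X, F_B^n = {v ∈ B : N(v) ⊆ F_A^n}, and F_A^{n+1} = X ∪ {a ∈ A : N(a) ⊆ F_B^n}. Then the cascade stabilizes after one stage: for every n ≥ 0, F_B^n = {v ∈ B : N(v) ⊆ X}, and for every n ≥ 1, F_A^n = F_A^1. -/
/-- In a bidirectional interdependent network with star topologies
(modeled by a finite bipartite graph with parts `A`, `B` and adjacency `adj`),
the cascading failure process started by removing `X ⊆ A`, given by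
`F_A^0 = X`, `F_B^n = {v ∈ B : N(v) ⊆ F_A^n}`, and
`F_A^{n+1} = X ∪ {a ∈ A : N(a) ⊆ F_B^n}`, stabilizes after one stage:
for every `n ≥ 0`, `F_B^n = {v ∈ B : N(v) ⊆ X}`, and for every `n ≥ 1`,
`F_A^n = F_A^1`. -/
theorem cascade_stabilizes_one_stage
    {A B : Type*} [Fintype A] [Fintype B] [DecidableEq A] [DecidableEq B]
    (adj : A → B → Prop) [∀ a b, Decidable (adj a b)]
    (X : Finset A) (FA : ℕ → Finset A) (FB : ℕ → Finset B)
    (hFA0 : FA 0 = X)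
    (hFB : ∀ n, FB n =
      Finset.univ.filter (fun v : B => (Finset.univ.filter (fun a : A => adj a v)) ⊆ FA n))
    (hFA : ∀ n, FA (n + 1) =
      X ∪ Finset.univ.filter (fun a : A => (Finset.univ.filter (fun v : B => adj a v)) ⊆ FB n)) :
    (∀ n, FB n =
      Finset.univ.filter (fun v : B => (Finset.univ.filter (fun a : A => adj a v)) ⊆ X)) ∧
    (∀ n, 1 ≤ n → FA n = FA 1) := by
  have hB : ∀ n, FB n =
      Finset.univ.filter (fun v : B => (Finset.univ.filter (fun a : A => adj a v)) ⊆ X) := by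
    intro n
    induction n with
    | zero => rw [hFB, hFA0]
    | succ n ih =>
      ext v
      rw [hFB, hFA, ih]
      simp only [Finset.mem_filter, Finset.mem_univ, true_and]
      refine ⟨fun h a ha => ?_, fun h => h.trans Finset.subset_union_left⟩
      rcases Finset.mem_union.mp (h ha) with haX | haF
      · exact haX
      · -- a failed neighbour of `v` outside `X` forces `v` to have failed already
        simp only [Finset.mem_filter, Finset.mem_univ, true_and] at haF ha
        have hv := haF (Finset.mem_filter.mpr ⟨Finset.mem_univ v, ha⟩)
        exact (Finset.mem_filter.mp hv).2 (Finset.mem_filter.mpr ⟨Finset.mem_univ a, ha⟩)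
  refine ⟨hB, fun n hn => ?_⟩
  obtain ⟨m, rfl⟩ := Nat.exists_eq_add_of_le' hn
  rw [hFA m, hFA 0, hB m, hB 0]
end

section
/- For every D with 1 ≤ D ≤ |B|, MRB(D) = min over i ∈ {0, 1, …, D} of (MR(i) + D − i), where MR(0) = 0. -/
/-- In a bidirectional interdependent network with star topologies
(finite bipartite graph, neighborhoods `N : B → Finset A`; removing `X ⊆ A`
fails exactly the `v ∈ B` with `N(v) ⊆ X`), with
`MR(i) = min{|X| : X ⊆ A, |{v ∈ B : N(v) ⊆ X}| ≥ i}` (so `MR(0) = 0`) and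
`MRB(D) = min{|X| + |Z| : X ⊆ A, Z ⊆ B, |Z ∪ {v ∈ B : N(v) ⊆ X}| ≥ D}`,
for every `D` with `1 ≤ D ≤ |B|`:
`MRB(D) = min_{0 ≤ i ≤ D} (MR(i) + D − i)`. -/
theorem MRB_eq_min_MR
    {A B : Type*} [Fintype A] [Fintype B] [DecidableEq A] [DecidableEq B]
    (N : B → Finset A) (D : ℕ) (hD1 : 1 ≤ D) (hD2 : D ≤ Fintype.card B) :
    sInf {n : ℕ | ∃ (X : Finset A) (Z : Finset B), X.card + Z.card = n ∧
        D ≤ (Z ∪ Finset.univ.filter (fun v : B => N v ⊆ X)).card} =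
    sInf {m : ℕ | ∃ i ≤ D, m =
        sInf {n : ℕ | ∃ X : Finset A, X.card = n ∧
          i ≤ (Finset.univ.filter (fun v : B => N v ⊆ X)).card} + (D - i)} := by
  apply le_antisymm
  · refine le_csInf ⟨_, 0, Nat.zero_le D, rfl⟩ ?_
    rintro m ⟨i, hi, rfl⟩
    obtain ⟨X, hX, hiX⟩ := Nat.sInf_mem (s := {n : ℕ | ∃ X : Finset A, X.card = n ∧
      i ≤ (Finset.univ.filter (fun v : B => N v ⊆ X)).card})
      ⟨_, Finset.univ, rfl, by simpa using hi.trans hD2⟩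
    rw [← hX]
    set F := Finset.univ.filter (fun v : B => N v ⊆ X) with hF
    obtain ⟨T, hFT, -, hT⟩ := Finset.exists_subsuperset_card_eq (Finset.subset_univ F)
      (le_max_right D F.card) (max_le hD2 (Finset.card_le_univ F))
    have hcard := Finset.card_sdiff_add_card_eq_card hFT
    refine le_trans (b := X.card + (T \ F).card) (Nat.sInf_le ⟨X, T \ F, rfl, ?_⟩) (by omega)
    rw [← hF, Finset.sdiff_union_of_subset hFT, hT]
    exact le_max_left _ _
  · refine le_csInf ⟨_, Finset.univ, Finset.univ, rfl, by simpa using hD2⟩ ?_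
    rintro n ⟨X, Z, rfl, h⟩
    have hunion := h.trans (Finset.card_union_le _ _)
    set F := Finset.univ.filter (fun v : B => N v ⊆ X) with hF
    have hMR : sInf {n : ℕ | ∃ X : Finset A, X.card = n ∧
        min F.card D ≤ (Finset.univ.filter (fun v : B => N v ⊆ X)).card} ≤ X.card :=
      Nat.sInf_le ⟨X, rfl, min_le_left _ _⟩
    exact le_trans (Nat.sInf_le ⟨min F.card D, min_le_right _ _, rfl⟩)
      (Nat.add_le_add hMR (by omega))
end

section
/- Bidirectional interdependency is at least as robust as unidirectional interdependency with the same support edges from A to B: for any unidirectional interdependent network with relations R ⊆ A×B and S ⊆ B×A, and for every D with 1 ≤ D ≤ |B|, uniMR(D) ≤ biMR_R(D), where biMR_R(D) = min{|X| : X ⊆ A, |{v ∈ B : N_R(v) ⊆ X}| ≥ D} is the MR(D) value of the bidirectional interdependent network whose (undirected) interdependency edges are exactly the pairs in R and N_R(v) = {a ∈ A : (a,v) ∈ R}. -/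
/-- Bidirectional interdependency is at least as robust as
unidirectional interdependency with the same support edges from `A` to `B`:
for any unidirectional interdependent network with relations `R ⊆ A×B` and
`S ⊆ B×A` (every vertex of `B` has an `R`-in-neighbor, every vertex of `A` has
an `S`-in-neighbor, and `(F_A(X), F_B(X))` is the least pair of failed sets
closed under the cascade rules), and for every `D` with `1 ≤ D ≤ |B|`,
`uniMR(D) ≤ biMR_R(D)`, where
`uniMR(D) = min{|X| : X ⊆ A, |F_B(X)| ≥ D}` and
`biMR_R(D) = min{|X| : X ⊆ A, |{v ∈ B : N_R(v) ⊆ X}| ≥ D}` with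
`N_R(v) = {a ∈ A : (a,v) ∈ R}`. -/
theorem uniMR_le_biMR
    {A B : Type*} [Fintype A] [Fintype B] [DecidableEq A] [DecidableEq B]
    (R : A → B → Prop) (S : B → A → Prop)
    [∀ a b, Decidable (R a b)] [∀ b a, Decidable (S b a)]
    (hR : ∀ b : B, ∃ a : A, R a b) (hS : ∀ a : A, ∃ b : B, S b a)
    (FA : Finset A → Finset A) (FB : Finset A → Finset B)
    (hsub : ∀ X, X ⊆ FA X)
    (hclB : ∀ (X : Finset A) (v : B), (∀ a : A, R a v → a ∈ FA X) → v ∈ FB X)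
    (hclA : ∀ (X : Finset A) (a : A), (∀ b : B, S b a → b ∈ FB X) → a ∈ FA X)
    (hleast : ∀ (X : Finset A) (P : Finset A) (Q : Finset B), X ⊆ P →
      (∀ v : B, (∀ a : A, R a v → a ∈ P) → v ∈ Q) →
      (∀ a : A, (∀ b : B, S b a → b ∈ Q) → a ∈ P) →
      FA X ⊆ P ∧ FB X ⊆ Q)
    (D : ℕ) (hD1 : 1 ≤ D) (hD2 : D ≤ Fintype.card B) :
    sInf {n : ℕ | ∃ X : Finset A, X.card = n ∧ D ≤ (FB X).card} ≤
    sInf {n : ℕ | ∃ X : Finset A, X.card = n ∧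
      D ≤ (Finset.univ.filter (fun v : B =>
        (Finset.univ.filter (fun a : A => R a v)) ⊆ X)).card} := by
  refine le_csInf ⟨_, Finset.univ, rfl, by simpa using hD2⟩ ?_
  rintro n ⟨X, rfl, hX⟩
  refine Nat.sInf_le ⟨X, rfl, hX.trans (Finset.card_le_card fun v hv => ?_)⟩
  have hN := (Finset.mem_filter.mp hv).2
  exact hclB X v fun a ha => hsub X (hN (Finset.mem_filter.mpr ⟨Finset.mem_univ a, ha⟩))
end

section
/- The greedy algorithm removes at most D times the optimal number of nodes: let 1 ≤ D ≤ |B| and let m = min{|N(Y)| : Y ⊆ B, |Y| = D}. Suppose v_1, …, v_D are distinct vertices of B such that for each t ∈ {1, …, D}, the vertex v_t minimizes |N(v) \ R_{t−1}| over all v ∈ B \ {v_1, …, v_{t−1}}, where R_{t−1} = N({v_1, …, v_{t−1}}). Then |N({v_1, …, v_D})| ≤ D·m. -/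
/-- If every step `t < k` of a sequence `v` chooses a vertex with the fewest uncovered neighbors, then
the first `k` vertices cover at most `k * |N(Y)|` elements, for every `Y` with at least `k` elements. -/
theorem card_biUnion_greedy_le {A B : Type*} [DecidableEq A] [DecidableEq B]
    (N : B → Finset A) (v : ℕ → B) (Y : Finset B) (k : ℕ) (hk : k ≤ Y.card)
    (hgreedy : ∀ t < k, ∀ b : B, b ∉ (Finset.range t).image v →
      (N (v t) \ ((Finset.range t).image v).biUnion N).card ≤
      (N b \ ((Finset.range t).image v).biUnion N).card) :
    (((Finset.range k).image v).biUnion N).card ≤ k * (Y.biUnion N).card := by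
  induction k with
  | zero => simp
  | succ t ih =>
    have hcard : ((Finset.range t).image v).card < Y.card :=
      (Finset.card_image_le.trans_eq (Finset.card_range t)).trans_lt hk
    obtain ⟨y, hyY, hy⟩ := Finset.exists_mem_notMem_of_card_lt_card hcard
    have hstep := hgreedy t t.lt_succ_self y hy
    have hle : (N y \ ((Finset.range t).image v).biUnion N).card ≤ (Y.biUnion N).card :=
      Finset.card_le_card (Finset.sdiff_subset.trans (Finset.subset_biUnion_of_mem N hyY))
    have hrec := ih (by omega) fun s hs => hgreedy s (by omega)
    rw [Finset.range_add_one, Finset.image_insert, Finset.biUnion_insert,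
      ← Finset.sdiff_union_self_eq_union, add_mul, one_mul]
    exact (Finset.card_union_le _ _).trans (by omega)

/-- The greedy algorithm removes at most `D` times the optimal
number of nodes. In a finite bipartite graph with parts `A`, `B` and
neighborhoods `N : B → Finset A` (with `N(S) = ⋃_{v ∈ S} N(v)`), let
`1 ≤ D ≤ |B|` and `m = min{|N(Y)| : Y ⊆ B, |Y| = D}` (which equals `MR(D)`).
Suppose `v_1, …, v_D` (here `v 0, …, v (D-1)`) are distinct vertices of `B`
such that for each `t`, the vertex `v t` minimizes `|N(b) \ R_t|` over all
`b ∈ B` outside `{v 0, …, v (t-1)}`, where `R_t = N({v 0, …, v (t-1)})`.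
Then `|N({v 0, …, v (D-1)})| ≤ D·m`. -/
theorem greedy_le_D_times_optimal
    {A B : Type*} [Fintype A] [Fintype B] [DecidableEq A] [DecidableEq B]
    (N : B → Finset A) (D : ℕ) (hD1 : 1 ≤ D) (hD2 : D ≤ Fintype.card B)
    (m : ℕ)
    (hm : m = sInf {n : ℕ | ∃ Y : Finset B, Y.card = D ∧ (Y.biUnion N).card = n})
    (v : ℕ → B)
    (hinj : ∀ i < D, ∀ j < D, v i = v j → i = j)
    (hgreedy : ∀ t < D, ∀ b : B, b ∉ (Finset.range t).image v →
      (N (v t) \ ((Finset.range t).image v).biUnion N).card ≤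
      (N b \ ((Finset.range t).image v).biUnion N).card) :
    (((Finset.range D).image v).biUnion N).card ≤ D * m := by
  have hne : {n : ℕ | ∃ Y : Finset B, Y.card = D ∧ (Y.biUnion N).card = n}.Nonempty := by
    obtain ⟨Y, -, hY⟩ := Finset.exists_subset_card_eq (s := (Finset.univ : Finset B)) hD2
    exact ⟨_, Y, hY, rfl⟩
  obtain ⟨Y, hYD, hYm⟩ := Nat.sInf_mem hne
  rw [hm, ← hYm]
  exact card_biUnion_greedy_le N v Y D hYD.ge hgreedy
end

section
/- The worst-case bound D·MR(D) for the greedy algorithm is tight: for integers X ≥ 1 and D ≥ 1, consider the bipartite graph in which A is partitioned into D+1 batches A_1, …, A_{D+1} each of size X, B = {b_1, …, b_{2D}}, each vertex b_i for 1 ≤ i ≤ D is adjacent exactly to the vertices of batch A_i, and each vertex b_{D+j} for 1 ≤ j ≤ D is adjacent exactly to the vertices of batch A_{D+1}. Then every vertex of B has degree exactly X, min{|N(Y)| : Y ⊆ B, |Y| = D} = X, and the vertices b_1, …, b_D have pairwise disjoint neighborhoods so that |N({b_1, …, b_D})| = D·X. -/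
/-- The worst-case bound `D·MR(D)` for the greedy algorithm is
tight. For integers `K ≥ 1` (batch size, called `X` in the paper) and `D ≥ 1`,
consider the bipartite graph whose `A`-side is `Fin (D+1) × Fin K` (batch
`A_{i+1}` is `{i} × Fin K`), whose `B`-side is `Fin (2*D)`, where vertex
`b` with `b < D` is adjacent exactly to batch `A_{b+1}` and vertex `b` with
`b ≥ D` is adjacent exactly to batch `A_{D+1}`. Then every vertex of `B` has
degree exactly `K`, `min{|N(Y)| : Y ⊆ B, |Y| = D} = K` (i.e. `MR(D) = K`), and
the vertices `b_1, …, b_D` have pairwise disjoint neighborhoods, so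
`|N({b_1, …, b_D})| = D·K`. -/
theorem greedy_bound_tight
    (K D : ℕ) (hK : 1 ≤ K) (hD : 1 ≤ D)
    (N : Fin (2 * D) → Finset (Fin (D + 1) × Fin K))
    (hN : ∀ (b : Fin (2 * D)) (a : Fin (D + 1) × Fin K),
      a ∈ N b ↔ (if (b : ℕ) < D then (a.1 : ℕ) = (b : ℕ) else (a.1 : ℕ) = D)) :
    (∀ b : Fin (2 * D), (N b).card = K) ∧
    sInf {n : ℕ | ∃ Y : Finset (Fin (2 * D)), Y.card = D ∧ (Y.biUnion N).card = n} = K ∧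
    (∀ i j : Fin (2 * D), (i : ℕ) < D → (j : ℕ) < D → i ≠ j → Disjoint (N i) (N j)) ∧
    ((Finset.univ.filter (fun b : Fin (2 * D) => (b : ℕ) < D)).biUnion N).card = D * K := by
  have hbatch : ∀ b : Fin (2 * D),
      N b = {(⟨min (b : ℕ) D, by omega⟩ : Fin (D + 1))} ×ˢ Finset.univ := by
    intro b
    ext a
    simp only [hN, Finset.mem_product, Finset.mem_singleton, Finset.mem_univ, and_true, Fin.ext_iff]
    split_ifs <;> omega
  have hdeg : ∀ b : Fin (2 * D), (N b).card = K := by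
    intro b
    simp [hbatch]
  have hdisj : ∀ i j : Fin (2 * D), (i : ℕ) < D → (j : ℕ) < D → i ≠ j →
      Disjoint (N i) (N j) := by
    intro i j hi hj hij
    rw [Finset.disjoint_left]
    intro a hai haj
    rw [hN, if_pos hi] at hai
    rw [hN, if_pos hj] at haj
    exact hij (Fin.ext (hai.symm.trans haj))
  have hlow : (Finset.univ.filter (fun b : Fin (2 * D) => (b : ℕ) < D)).card = D := by
    rw [Fin.card_filter_val_lt]
    omega
  have hhigh : (Finset.univ.filter (fun b : Fin (2 * D) => ¬ (b : ℕ) < D)).card = D := by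
    have h := Finset.card_filter_add_card_filter_not
      (s := (Finset.univ : Finset (Fin (2 * D)))) (fun b : Fin (2 * D) => (b : ℕ) < D)
    rw [hlow, Finset.card_univ, Fintype.card_fin] at h
    omega
  refine ⟨hdeg, IsLeast.csInf_eq ⟨⟨_, hhigh, ?_⟩, ?_⟩, hdisj, ?_⟩
  · let b₀ : Fin (2 * D) := ⟨D, by omega⟩
    refine Eq.trans ?_ (hdeg b₀)
    congr 1
    ext a
    simp only [Finset.mem_biUnion, Finset.mem_filter, Finset.mem_univ, true_and]
    constructor
    · rintro ⟨b, hb, ha⟩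
      rw [hN, if_neg hb] at ha
      rwa [hN, if_neg (lt_irrefl D)]
    · exact fun ha => ⟨b₀, lt_irrefl D, ha⟩
  · rintro n ⟨Y, hY, rfl⟩
    obtain ⟨b, hb⟩ : Y.Nonempty := Finset.card_pos.mp (by omega)
    refine (hdeg b).symm.trans_le ?_
    exact Finset.card_le_card (Finset.subset_biUnion_of_mem N hb)
  · rw [Finset.card_biUnion, Finset.sum_congr rfl fun b _ => hdeg b, Finset.sum_const, hlow,
      smul_eq_mul]
    intro i hi j hj
    exact hdisj i j (Finset.mem_filter.mp hi).2 (Finset.mem_filter.mp hj).2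
end

section
/- If k ≥ 2, |A| = |B| = N with 1 ≤ N ≤ k(k−1), and every vertex of A and every vertex of B has degree exactly k, then there exist two distinct vertices u, v ∈ B with |N(u) ∩ N(v)| ≥ 2 (equivalently, |N(u) ∪ N(v)| ≤ 2k − 2, so MR(2) < 2k − 1). -/
/-- In a finite bipartite graph with parts `A`, `B` and adjacency
`adj`, if `k ≥ 2`, `|A| = |B| = N` with `1 ≤ N ≤ k(k−1)`, and every vertex of
`A` and every vertex of `B` has degree exactly `k`, then there exist two
distinct vertices `u, v ∈ B` with `|N(u) ∩ N(v)| ≥ 2` (equivalently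
`|N(u) ∪ N(v)| ≤ 2k − 2`, so `MR(2) < 2k − 1`). -/
theorem small_regular_two_common_neighbors
    {A B : Type*} [Fintype A] [Fintype B] [DecidableEq A] [DecidableEq B]
    (adj : A → B → Prop) [∀ a b, Decidable (adj a b)] (k N : ℕ)
    (hk : 2 ≤ k) (hN1 : 1 ≤ N) (hN2 : N ≤ k * (k - 1))
    (hcardA : Fintype.card A = N) (hcardB : Fintype.card B = N)
    (hregA : ∀ a : A, (Finset.univ.filter (fun b : B => adj a b)).card = k)
    (hregB : ∀ v : B, (Finset.univ.filter (fun a : A => adj a v)).card = k) :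
    ∃ u v : B, u ≠ v ∧
      2 ≤ ((Finset.univ.filter (fun a : A => adj a u)) ∩
        (Finset.univ.filter (fun a : A => adj a v))).card := by
  by_contra! hsmall
  obtain ⟨u⟩ : Nonempty B := Fintype.card_pos_iff.mp (by omega)
  -- Double count the pairs `(a, v)` with `a ∈ N(u) ∩ N(v)` and `v ≠ u`.
  have hcount := Finset.sum_card_bipartiteAbove_eq_sum_card_bipartiteBelow
    (s := Finset.univ.filter (fun a : A => adj a u)) (t := Finset.univ.erase u) adj
  have hleft : ∀ a ∈ Finset.univ.filter (fun a : A => adj a u),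
      ((Finset.univ.erase u).bipartiteAbove adj a).card = k - 1 := by
    intro a ha
    rw [Finset.bipartiteAbove, Finset.filter_erase, Finset.card_erase_of_mem, hregA]
    simpa using ha
  have hright : ∀ v ∈ Finset.univ.erase u,
      ((Finset.univ.filter (fun a : A => adj a u)).bipartiteBelow adj v).card ≤ 1 := by
    intro v hv
    have h := hsmall u v (Finset.ne_of_mem_erase hv).symm
    rw [← Finset.filter_and, ← Finset.filter_filter] at h
    exact Nat.le_of_lt_succ h
  rw [Finset.sum_congr rfl hleft, Finset.sum_const, hregB, smul_eq_mul] at hcount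
  have hle := Finset.sum_le_card_nsmul _ _ 1 hright
  rw [← hcount, Finset.card_erase_of_mem (Finset.mem_univ u), Finset.card_univ, hcardB,
    smul_eq_mul, mul_one] at hle
  omega
end

section
/- Blowing up each vertex of B into W copies converts MR into MRB: let G be a finite bipartite graph with parts A and B, let W > |A| + |B| be a positive integer, and let G' be the bipartite graph with parts A and B' = B × {1, …, W} where a ∈ A is adjacent to (b, i) in G' if and only if a is adjacent to b in G. Then for every D with 1 ≤ D ≤ |B|, MRB_{G'}(W·D) = MR_G(D). -/
/-- Blowing up each vertex of `B` into `W` copies converts `MR`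
into `MRB`: let `G` be a finite bipartite graph with parts `A` and `B`
(neighborhoods `Nbr : B → Finset A`), let `W > |A| + |B|`, and let `G'` be the
bipartite graph with parts `A` and `B' = B × Fin W` where `a ∈ A` is adjacent
to `(b, i)` iff `a` is adjacent to `b` in `G` (so the `G'`-neighborhood of
`(b, i)` is `Nbr b`). Then for every `D` with `1 ≤ D ≤ |B|`,
`MRB_{G'}(W·D) = MR_G(D)`, where
`MRB_{G'}(D') = min{|X| + |Z| : X ⊆ A, Z ⊆ B', |Z ∪ {v ∈ B' : N(v) ⊆ X}| ≥ D'}`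
and `MR_G(D) = min{|N(Y)| : Y ⊆ B, |Y| = D}`. -/
theorem blowup_MRB_eq_MR
    {A B : Type*} [Fintype A] [Fintype B] [DecidableEq A] [DecidableEq B]
    (Nbr : B → Finset A) (W : ℕ) (hW : Fintype.card A + Fintype.card B < W)
    (D : ℕ) (hD1 : 1 ≤ D) (hD2 : D ≤ Fintype.card B) :
    sInf {n : ℕ | ∃ (X : Finset A) (Z : Finset (B × Fin W)),
        X.card + Z.card = n ∧
        W * D ≤ (Z ∪ Finset.univ.filter (fun v : B × Fin W => Nbr v.1 ⊆ X)).card} =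
    sInf {n : ℕ | ∃ Y : Finset B, Y.card = D ∧ (Y.biUnion Nbr).card = n} := by
  have filter_card : ∀ X : Finset A,
      (Finset.univ.filter (fun v : B × Fin W => Nbr v.1 ⊆ X)).card =
        W * (Finset.univ.filter (fun b : B => Nbr b ⊆ X)).card := by
    intro X
    have h : Finset.univ.filter (fun v : B × Fin W => Nbr v.1 ⊆ X) =
        (Finset.univ.filter (fun b : B => Nbr b ⊆ X)) ×ˢ Finset.univ := by
      ext v
      simp
    rw [h, Finset.card_product, Finset.card_univ, Fintype.card_fin, mul_comm]
  have cost_of_set : ∀ Y : Finset B, Y.card = D →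
      (Y.biUnion Nbr).card ∈ {n : ℕ | ∃ (X : Finset A) (Z : Finset (B × Fin W)),
        X.card + Z.card = n ∧
        W * D ≤ (Z ∪ Finset.univ.filter (fun v : B × Fin W => Nbr v.1 ⊆ X)).card} := by
    intro Y hY
    refine ⟨Y.biUnion Nbr, ∅, by simp, ?_⟩
    rw [Finset.empty_union, filter_card, ← hY]
    refine Nat.mul_le_mul_left W (Finset.card_le_card fun b hb => ?_)
    simpa using Finset.subset_biUnion_of_mem Nbr hb
  obtain ⟨Y₀, -, hY₀⟩ := Finset.exists_subset_card_eq
    (s := (Finset.univ : Finset B)) (n := D) (by rwa [Finset.card_univ])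
  apply le_antisymm
  · refine le_csInf ⟨_, Y₀, hY₀, rfl⟩ ?_
    rintro n ⟨Y, hY, rfl⟩
    exact Nat.sInf_le (cost_of_set Y hY)
  · refine le_csInf ⟨_, cost_of_set Y₀ hY₀⟩ ?_
    rintro n ⟨X, Z, rfl, hXZ⟩
    by_cases hS : D ≤ (Finset.univ.filter (fun b : B => Nbr b ⊆ X)).card
    · obtain ⟨Y, hYS, hY⟩ := Finset.exists_subset_card_eq hS
      refine le_trans (Nat.sInf_le ⟨Y, hY, rfl⟩) ?_
      refine (Finset.card_le_card (Finset.biUnion_subset.2 fun b hb => ?_)).trans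
        (Nat.le_add_right _ _)
      exact (Finset.mem_filter.1 (hYS hb)).2
    · have hZ : W ≤ Z.card := by
        have h := hXZ.trans (Finset.card_union_le _ _)
        rw [filter_card] at h
        have hmul := Nat.mul_le_mul_left W (Nat.succ_le_of_lt (not_le.1 hS))
        rw [Nat.mul_succ] at hmul
        omega
      refine le_trans (Nat.sInf_le ⟨Y₀, hY₀, rfl⟩) ?_
      have hA := Finset.card_le_univ (Y₀.biUnion Nbr)
      omega
end

section
/- Let N > 0, k > 1, and r ≥ 1 be real numbers with r − k(r−1) ≥ 0, let I be a finite nonempty set of nonnegative real numbers, and let W*, W : I → ℝ satisfy 0 ≤ W*(D) ≤ W(D) ≤ r·W*(D) and N − W*(D) ≥ N/k for all D ∈ I. Then for every D ∈ I, (r − k(r−1))·(N − W*(D)) ≤ N − W(D) ≤ N − W*(D), and consequently (r − k(r−1))·max_{D∈I} min(D, N − W*(D)) ≤ max_{D∈I} min(D, N − W(D)) ≤ max_{D∈I} min(D, N − W*(D)). -/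
/-- Quantitative core of the inapproximability argument for
`MR(D)`. Let `N > 0`, `k > 1`, `r ≥ 1` be reals with `r − k(r−1) ≥ 0`, let `I`
be a finite nonempty set of nonnegative reals, and let `W*, W : I → ℝ` satisfy
`0 ≤ W*(D) ≤ W(D) ≤ r·W*(D)` and `N − W*(D) ≥ N/k` for all `D ∈ I`. Then for
every `D ∈ I`,
`(r − k(r−1))·(N − W*(D)) ≤ N − W(D) ≤ N − W*(D)`, and consequently
`(r − k(r−1))·max_{D∈I} min(D, N − W*(D)) ≤ max_{D∈I} min(D, N − W(D))`
`≤ max_{D∈I} min(D, N − W*(D))`. -/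
theorem inapproximability_core
    (N k r : ℝ) (hN : 0 < N) (hk : 1 < k) (hr : 1 ≤ r)
    (hrk : 0 ≤ r - k * (r - 1))
    (I : Finset ℝ) (hI : I.Nonempty) (hIpos : ∀ D ∈ I, 0 ≤ D)
    (Wstar W : ℝ → ℝ)
    (h0 : ∀ D ∈ I, 0 ≤ Wstar D)
    (h1 : ∀ D ∈ I, Wstar D ≤ W D)
    (h2 : ∀ D ∈ I, W D ≤ r * Wstar D)
    (h3 : ∀ D ∈ I, N / k ≤ N - Wstar D) :
    (∀ D ∈ I, (r - k * (r - 1)) * (N - Wstar D) ≤ N - W D ∧ N - W D ≤ N - Wstar D) ∧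
    ((r - k * (r - 1)) * I.sup' hI (fun D => min D (N - Wstar D)) ≤
        I.sup' hI (fun D => min D (N - W D)) ∧
      I.sup' hI (fun D => min D (N - W D)) ≤
        I.sup' hI (fun D => min D (N - Wstar D))) := by
  have hc : r - k * (r - 1) ≤ 1 := by nlinarith
  have key : ∀ D ∈ I,
      (r - k * (r - 1)) * (N - Wstar D) ≤ N - W D ∧ N - W D ≤ N - Wstar D := by
    intro D hD
    have hNk : N ≤ (N - Wstar D) * k := (div_le_iff₀ (by linarith)).1 (h3 D hD)
    have hmul := mul_le_mul_of_nonneg_left hNk (sub_nonneg.2 hr)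
    exact ⟨by linarith [h2 D hD], by linarith [h1 D hD]⟩
  refine ⟨key, ?_, ?_⟩
  · obtain ⟨D, hD, hmax⟩ := I.exists_mem_eq_sup' hI (fun D => min D (N - Wstar D))
    rw [hmax]
    refine le_trans ?_ (Finset.le_sup' (fun D => min D (N - W D)) hD)
    rw [mul_min_of_nonneg _ _ hrk]
    exact min_le_min (mul_le_of_le_one_left (hIpos D hD) hc) (key D hD).1
  · exact Finset.sup'_mono_fun fun D hD => min_le_min le_rfl (key D hD).2
end
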